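/- Let m ≥ 5, let a, b be distinct points of ZMod m, and let U, V, W be three distinct points of ZMod m none of which equals a or b. Then the number of pairs among {U, V}, {U, W}, {V, W} that are linked with {a, b} is even (it equals 0 or 2). (This is the combinatorial core of the paper's parity axiom 3: among the three crossings taking part in a third Reidemeister move, the number of odd crossings is even.) -/

import Mathlib

/-- `x` lies strictly between `a` and `b` in the cyclic order on `ZMod m`:
writing `b = a + j` with `j = (b - a).val`, `x = a + k` for some `1 ≤ k ≤ j - 1`. -/
def inOpenArc {m : ℕ} (a b x : ZMod m) : Prop :=
  ∃ k : ℕ, 1 ≤ k ∧ k < (b - a).val ∧ x = a + (k : ZMod m)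

/-- The pairs `{a, b}` and `{c, d}` are linked: exactly one of `c`, `d`
lies in the open arc from `a` to `b`. -/
def linked {m : ℕ} (a b c d : ZMod m) : Prop :=
  Xor' (inOpenArc a b c) (inOpenArc a b d)

/-- Linking of unordered pairs (given as two-element finsets). -/
def linkedPair {m : ℕ} (P Q : Finset (ZMod m)) : Prop :=
  ∃ a b c d : ZMod m, P = {a, b} ∧ Q = {c, d} ∧ linked a b c d

/-- The chords of a chord diagram given by an involution `f` of `ZMod (2*n)`. -/
def chords {n : ℕ} (f : ZMod (2 * n) → ZMod (2 * n)) : Set (Finset (ZMod (2 * n))) :=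
  {P | ∃ a, P = {a, f a}}

theorem arc_iff {m : ℕ} (hm : 5 ≤ m) (a b x : ZMod m) : inOpenArc a b x ↔
    ((a.val < x.val ∧ x.val < b.val) ∨ (b.val < a.val ∧ a.val < x.val) ∨
      (x.val < b.val ∧ b.val < a.val)) := by
  have : NeZero m := ⟨by omega⟩
  have key : ∀ y : ZMod m, (a.val ≤ y.val ∧ (y - a).val + a.val = y.val) ∨
      (y.val < a.val ∧ (y - a).val + a.val = y.val + m) := by
    intro y
    have h1 := ZMod.val_add (y - a) a
    rw [sub_add_cancel] at h1
    have h2 := ZMod.val_lt (y - a)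
    have h3 := ZMod.val_lt a
    have h4 := ZMod.val_lt y
    by_cases h : (y - a).val + a.val < m
    · rw [Nat.mod_eq_of_lt h] at h1
      omega
    · rw [Nat.mod_eq_sub_mod (by omega), Nat.mod_eq_of_lt (by omega)] at h1
      omega
  have h : inOpenArc a b x ↔ 1 ≤ (x - a).val ∧ (x - a).val < (b - a).val := by
    constructor
    · rintro ⟨k, h1, h2, rfl⟩
      have := ZMod.val_lt (b - a)
      rw [add_sub_cancel_left, ZMod.val_natCast_of_lt (by omega)]
      exact ⟨h1, h2⟩
    · rintro ⟨h1, h2⟩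
      refine ⟨_, h1, h2, ?_⟩
      rw [ZMod.natCast_zmod_val]
      ring
  rw [h]
  have hx := key x
  have hb := key b
  have h1 := ZMod.val_lt a
  have h2 := ZMod.val_lt b
  have h3 := ZMod.val_lt x
  omega

theorem pair_cases {α : Type*} [DecidableEq α] {a b c d : α}
    (h : ({a, b} : Finset α) = {c, d}) : (c = a ∧ d = b) ∨ (c = b ∧ d = a) := by
  have h' : ({a, b} : Set α) = {c, d} := by
    have := congrArg (fun s : Finset α => (s : Set α)) h
    simpa using this
  rcases Set.pair_eq_pair_iff.1 h' with ⟨h1, h2⟩ | ⟨h1, h2⟩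
  · exact Or.inl ⟨h1.symm, h2.symm⟩
  · exact Or.inr ⟨h2.symm, h1.symm⟩

theorem linkedPair_iff' {m : ℕ} (hm : 5 ≤ m) {a b U V : ZMod m} (hab : a ≠ b) (hUV : U ≠ V)
    (hU : U ≠ a ∧ U ≠ b) (hV : V ≠ a ∧ V ≠ b) :
    linkedPair ({U, V} : Finset (ZMod m)) {a, b} ↔ ¬ (inOpenArc a b U ↔ inOpenArc a b V) := by
  have : NeZero m := ⟨by omega⟩
  have inj : ∀ x y : ZMod m, x ≠ y → x.val ≠ y.val := fun x y h h' => h (ZMod.val_injective m h')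
  have e1 := inj _ _ hab
  have e2 := inj _ _ hUV
  have e3 := inj _ _ hU.1
  have e4 := inj _ _ hU.2
  have e5 := inj _ _ hV.1
  have e6 := inj _ _ hV.2
  constructor
  · rintro ⟨p, q, c, d, h1, h2, h3⟩
    unfold linked Xor' Xor at h3
    simp only [arc_iff hm] at h3 ⊢
    rcases pair_cases h1 with ⟨rfl, rfl⟩ | ⟨rfl, rfl⟩ <;>
    rcases pair_cases h2 with ⟨rfl, rfl⟩ | ⟨rfl, rfl⟩ <;> omega
  · intro h
    refine ⟨U, V, a, b, rfl, rfl, ?_⟩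
    unfold linked Xor' Xor
    simp only [arc_iff hm] at h ⊢
    omega

/-- Among the three pairs formed by three points, an even number (0 or 2)
are linked with a given pair {a, b}. -/
theorem triangle_even_linking (m : ℕ) (hm : 5 ≤ m) (a b U V W : ZMod m)
    (hab : a ≠ b) (hUV : U ≠ V) (hUW : U ≠ W) (hVW : V ≠ W)
    (hU : U ≠ a ∧ U ≠ b) (hV : V ≠ a ∧ V ≠ b) (hW : W ≠ a ∧ W ≠ b) :
    Even (Set.ncard
      {P ∈ ({({U, V} : Finset (ZMod m)), {U, W}, {V, W}} : Set (Finset (ZMod m))) |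
        linkedPair P ({a, b} : Finset (ZMod m))}) := by
  have n1 : ({U, V} : Finset (ZMod m)) ≠ {U, W} := fun h => by
    rcases pair_cases h with ⟨_, h⟩ | ⟨h, _⟩
    · exact hVW h.symm
    · exact hUV h
  have n2 : ({U, V} : Finset (ZMod m)) ≠ {V, W} := fun h => by
    rcases pair_cases h with ⟨h, _⟩ | ⟨_, h⟩
    · exact hUV h.symm
    · exact hUW h.symm
  have n3 : ({U, W} : Finset (ZMod m)) ≠ {V, W} := fun h => by
    rcases pair_cases h with ⟨h, _⟩ | ⟨h, _⟩
    · exact hUV h.symm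
    · exact hVW h
  have l1 := linkedPair_iff' hm hab hUV hU hV
  have l2 := linkedPair_iff' hm hab hUW hU hW
  have l3 := linkedPair_iff' hm hab hVW hV hW
  generalize ({U, V} : Finset (ZMod m)) = A at *
  generalize ({U, W} : Finset (ZMod m)) = B at *
  generalize ({V, W} : Finset (ZMod m)) = C at *
  have gen : ∀ S T : Set (Finset (ZMod m)), S = T → Even T.ncard → Even S.ncard := by
    rintro S T rfl h
    exact h
  have two : ∀ x y : Finset (ZMod m), x ≠ y → Even (Set.ncard {x, y}) := by
    intro x y h
    rw [Set.ncard_pair h]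
    exact even_two
  have hcase : (¬ linkedPair A {a, b} ∧ ¬ linkedPair B {a, b} ∧ ¬ linkedPair C {a, b}) ∨
      (linkedPair A {a, b} ∧ linkedPair B {a, b} ∧ ¬ linkedPair C {a, b}) ∨
      (linkedPair A {a, b} ∧ ¬ linkedPair B {a, b} ∧ linkedPair C {a, b}) ∨
      (¬ linkedPair A {a, b} ∧ linkedPair B {a, b} ∧ linkedPair C {a, b}) := by
    rw [l1, l2, l3]
    clear l1 l2 l3 gen two n1 n2 n3
    by_cases p : inOpenArc a b U <;> by_cases q : inOpenArc a b V <;>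
      by_cases r : inOpenArc a b W <;> simp [p, q, r]
  rcases hcase with ⟨h1, h2, h3⟩ | ⟨h1, h2, h3⟩ | ⟨h1, h2, h3⟩ | ⟨h1, h2, h3⟩
  · refine gen _ ∅ ?_ (by simp)
    ext P
    simp only [Set.mem_setOf_eq, Set.mem_insert_iff, Set.mem_singleton_iff, Set.mem_empty_iff_false]
    grind
  · refine gen _ {A, B} ?_ (two _ _ n1)
    ext P
    simp only [Set.mem_setOf_eq, Set.mem_insert_iff, Set.mem_singleton_iff]
    grind
  · refine gen _ {A, C} ?_ (two _ _ n2)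
    ext P
    simp only [Set.mem_setOf_eq, Set.mem_insert_iff, Set.mem_singleton_iff]
    grind
  · refine gen _ {B, C} ?_ (two _ _ n3)
    ext P
    simp only [Set.mem_setOf_eq, Set.mem_insert_iff, Set.mem_singleton_iff]
    grind
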